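/- For every K > 0, the metric space (M_K(ℝ^d), WOP) is complete: every WOP-Cauchy sequence in M_K(ℝ^d) converges in WOP to a limit belonging to M_K(ℝ^d). -/

import Mathlib

open MeasureTheory

noncomputable section

abbrev Euc (d : ℕ) := EuclideanSpace ℝ (Fin d)

variable {d : ℕ}

/-- Total mass of a measure. -/
def mass (μ : Measure (Euc d)) : ℝ := (μ Set.univ).toReal

/-- Second moment centered at `x₀`. -/
def sndMoment (x₀ : Euc d) (μ : Measure (Euc d)) : ℝ := ∫ x, ‖x - x₀‖ ^ 2 ∂μ

/-- `μ ∈ M(ℝ^d)`: finite positive measure with finite second moment. -/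
def MemM (μ : Measure (Euc d)) : Prop :=
  IsFiniteMeasure μ ∧ Integrable (fun x => ‖x‖ ^ 2) μ

/-- `μ ∈ P₂(ℝ^d)`: probability measure with finite second moment. -/
def MemP2 (μ : Measure (Euc d)) : Prop :=
  IsProbabilityMeasure μ ∧ Integrable (fun x => ‖x‖ ^ 2) μ

/-- Squared 2-Wasserstein distance, as an infimum over couplings. -/
def W2sq (μ ν : Measure (Euc d)) : ℝ :=
  sInf { r : ℝ | ∃ π : Measure (Euc d × Euc d),
    π.map Prod.fst = μ ∧ π.map Prod.snd = ν ∧ r = ∫ p, ‖p.1 - p.2‖ ^ 2 ∂π }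

/-- 2-Wasserstein distance. -/
def W2 (μ ν : Measure (Euc d)) : ℝ := Real.sqrt (W2sq μ ν)

/-- The dilation `T_a(x) = a (x - x₀) + x₀`. -/
def dil (x₀ : Euc d) (a : ℝ) (x : Euc d) : Euc d := a • (x - x₀) + x₀

/-- Normalization `μ̄` of `μ`, with the convention `μ̄ = δ_{x₀}` for the null measure. -/
def nm (x₀ : Euc d) (μ : Measure (Euc d)) : Measure (Euc d) :=
  if μ Set.univ = 0 then Measure.dirac x₀ else (μ Set.univ)⁻¹ • μ

/-- Squared WOP metric with reference point `x₀`. -/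
def WOP2 (x₀ : Euc d) (μ ν : Measure (Euc d)) : ℝ :=
  (mass μ - mass ν) ^ 2 +
    W2sq ((nm x₀ μ).map (dil x₀ (mass μ))) ((nm x₀ ν).map (dil x₀ (mass ν)))

/-- The WOP metric with reference point `x₀`. -/
def WOP (x₀ : Euc d) (μ ν : Measure (Euc d)) : ℝ := Real.sqrt (WOP2 x₀ μ ν)


/-- `μ ∈ M_K(ℝ^d)`: control of the second moment by the mass. -/
def MemMK (x₀ : Euc d) (K : ℝ) (μ : Measure (Euc d)) : Prop :=
  MemM μ ∧ sndMoment x₀ μ ≤ K * mass μ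

open Filter Topology ENNReal

/-- Second moment centered at `x₀`, as an extended nonnegative real. -/
def lmoment (x₀ : Euc d) (μ : Measure (Euc d)) : ℝ≥0∞ := ∫⁻ x, ENNReal.ofReal (‖x - x₀‖ ^ 2) ∂μ

lemma W2sq_nonneg (μ ν : Measure (Euc d)) : 0 ≤ W2sq μ ν := by
  refine Real.sInf_nonneg ?_
  rintro r ⟨π, -, -, rfl⟩
  positivity

lemma W2sq_le_of_coupling {μ ν : Measure (Euc d)} {π : Measure (Euc d × Euc d)} {ε : ℝ}
    (hε : 0 ≤ ε) (h₁ : π.map Prod.fst = μ) (h₂ : π.map Prod.snd = ν)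
    (hπ : ∫⁻ p, ENNReal.ofReal (‖p.1 - p.2‖ ^ 2) ∂π ≤ ENNReal.ofReal ε) : W2sq μ ν ≤ ε := by
  have hle : ∫ p, ‖p.1 - p.2‖ ^ 2 ∂π ≤ ε := by
    rw [integral_eq_lintegral_of_nonneg_ae (ae_of_all _ fun p => by positivity)
      (Continuous.aestronglyMeasurable (by fun_prop))]
    exact ENNReal.toReal_le_of_le_ofReal hε hπ
  refine le_trans (csInf_le (a := ∫ p, ‖p.1 - p.2‖ ^ 2 ∂π) ⟨0, ?_⟩ ⟨π, h₁, h₂, rfl⟩) hle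
  rintro r ⟨π, -, -, rfl⟩
  positivity

lemma memLp_sub_of_lmoment_ne_top {x₀ : Euc d} {μ : Measure (Euc d)} (h : lmoment x₀ μ ≠ ∞) :
    MemLp (fun x => x - x₀) 2 μ := by
  refine (memLp_two_iff_integrable_sq_norm
    (Continuous.aestronglyMeasurable (by fun_prop))).2 ?_
  refine ⟨Continuous.aestronglyMeasurable (by fun_prop), ?_⟩
  rw [hasFiniteIntegral_iff_ofReal (ae_of_all _ fun x => by positivity)]
  exact h.lt_top

lemma lmoment_eq_ofReal_sndMoment (x₀ : Euc d) {μ : Measure (Euc d)} (h : MemM μ) :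
    lmoment x₀ μ = ENNReal.ofReal (sndMoment x₀ μ) := by
  have := h.1
  have h₁ : MemLp (fun x : Euc d => x) 2 μ :=
    (memLp_two_iff_integrable_sq_norm aestronglyMeasurable_id).2 h.2
  have h₂ : MemLp (fun x : Euc d => x - x₀) 2 μ := h₁.sub (memLp_const x₀)
  exact (ofReal_integral_eq_lintegral_ofReal
    ((memLp_two_iff_integrable_sq_norm h₂.1).1 h₂) (ae_of_all _ fun x => by positivity)).symm

lemma memM_of_lmoment_ne_top {x₀ : Euc d} {μ : Measure (Euc d)} [IsFiniteMeasure μ]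
    (h : lmoment x₀ μ ≠ ∞) : MemM μ := by
  have h₁ : MemLp (fun x : Euc d => (x - x₀) + x₀) 2 μ :=
    (memLp_sub_of_lmoment_ne_top h).add (memLp_const x₀)
  simp only [sub_add_cancel] at h₁
  exact ⟨inferInstance, (memLp_two_iff_integrable_sq_norm h₁.1).1 h₁⟩

lemma exists_coupling_of_W2sq_lt {x₀ : Euc d} {μ ν : Measure (Euc d)} [IsProbabilityMeasure μ]
    [IsProbabilityMeasure ν] (hμ : lmoment x₀ μ ≠ ∞) (hν : lmoment x₀ ν ≠ ∞) {ε : ℝ}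
    (h : W2sq μ ν < ε) :
    ∃ π : ProbabilityMeasure (Euc d × Euc d), (π : Measure (Euc d × Euc d)).map Prod.fst = μ ∧
      (π : Measure (Euc d × Euc d)).map Prod.snd = ν ∧
      ∫⁻ p, ENNReal.ofReal (‖p.1 - p.2‖ ^ 2) ∂(π : Measure (Euc d × Euc d)) ≤
        ENNReal.ofReal ε := by
  obtain ⟨r, ⟨π, h₁, h₂, rfl⟩, hr⟩ := exists_lt_of_csInf_lt
    (by exact ⟨_, μ.prod ν, by simp [Measure.map_fst_prod], by simp [Measure.map_snd_prod], rfl⟩) h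
  have hp : IsProbabilityMeasure π := by
    refine ⟨?_⟩
    have := congrArg (fun m => m Set.univ) h₁
    simpa [Measure.map_apply measurable_fst MeasurableSet.univ] using this
  refine ⟨⟨π, hp⟩, h₁, h₂, ?_⟩
  have m₁ : MemLp (fun p : Euc d × Euc d => p.1 - x₀) 2 π := by
    have := memLp_sub_of_lmoment_ne_top hμ
    rw [← h₁] at this
    exact this.comp_of_map measurable_fst.aemeasurable
  have m₂ : MemLp (fun p : Euc d × Euc d => p.2 - x₀) 2 π := by
    have := memLp_sub_of_lmoment_ne_top hν
    rw [← h₂] at this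
    exact this.comp_of_map measurable_snd.aemeasurable
  have m₃ : MemLp (fun p : Euc d × Euc d => p.1 - p.2) 2 π := by
    have := m₁.sub m₂
    simpa only [Pi.sub_def, sub_sub_sub_cancel_right] using this
  change ∫⁻ p, ENNReal.ofReal (‖p.1 - p.2‖ ^ 2) ∂π ≤ _
  rw [← ofReal_integral_eq_lintegral_ofReal ((memLp_two_iff_integrable_sq_norm m₃.1).1 m₃)
    (ae_of_all _ fun x => by positivity)]
  exact ENNReal.ofReal_le_ofReal hr.le

lemma lintegral_le_of_tendsto_probabilityMeasure {Ω : Type*} [MeasurableSpace Ω]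
    [TopologicalSpace Ω] [OpensMeasurableSpace Ω] [HasOuterApproxClosed Ω]
    {P : ℕ → ProbabilityMeasure Ω} {Q : ProbabilityMeasure Ω} (hP : Tendsto P atTop (𝓝 Q))
    {f : Ω → ℝ} (hf : Continuous f) (hf₀ : 0 ≤ f) {c : ℕ → ℝ≥0∞} {C : ℝ≥0∞}
    (hc : Tendsto c atTop (𝓝 C))
    (hle : ∀ n, ∫⁻ x, ENNReal.ofReal (f x) ∂(P n : Measure Ω) ≤ c n) :
    ∫⁻ x, ENNReal.ofReal (f x) ∂(Q : Measure Ω) ≤ C := by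
  refine (lintegral_le_liminf_lintegral_of_forall_isOpen_measure_le_liminf_measure hf hf₀
    fun G hG => ProbabilityMeasure.le_liminf_measure_open_of_tendsto hP hG).trans ?_
  rw [← hc.liminf_eq]
  exact liminf_le_liminf (Eventually.of_forall hle)

lemma isTightMeasureSet_of_lmoment_le {x₀ : Euc d} {S : Set (Measure (Euc d))} {B : ℝ≥0∞}
    (hB : B ≠ ∞) (hS : ∀ μ ∈ S, lmoment x₀ μ ≤ B) : IsTightMeasureSet S := by
  refine isTightMeasureSet_of_tendsto_measure_compl_closedBall (x := x₀) ?_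
  have hlim : Tendsto (fun r : ℝ => B / ENNReal.ofReal (r ^ 2)) atTop (𝓝 0) := by
    have h := ENNReal.tendsto_ofReal_atTop.comp (tendsto_pow_atTop (α := ℝ) two_ne_zero)
    have := ENNReal.Tendsto.const_div (a := B) h (Or.inr hB)
    simpa using! this
  refine tendsto_of_tendsto_of_tendsto_of_le_of_le' tendsto_const_nhds hlim
    (Eventually.of_forall fun _ => zero_le) ?_
  filter_upwards [eventually_gt_atTop 0] with r hr
  refine iSup₂_le fun μ hμ => ?_
  have hsub : (Metric.closedBall x₀ r)ᶜ ⊆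
      {x | ENNReal.ofReal (r ^ 2) ≤ ENNReal.ofReal (‖x - x₀‖ ^ 2)} := by
    intro x hx
    simp only [Set.mem_compl_iff, Metric.mem_closedBall, dist_eq_norm, not_le] at hx
    exact ENNReal.ofReal_le_ofReal (by gcongr)
  refine (measure_mono hsub).trans ?_
  refine (meas_ge_le_lintegral_div (by fun_prop)
    (by simpa using hr.ne') ENNReal.ofReal_ne_top).trans ?_
  exact ENNReal.div_le_div_right (hS μ hμ) _

lemma exists_tendsto_subseq_of_isTightMeasureSet {Ω : Type*} [MeasurableSpace Ω]
    [MetricSpace Ω] [SecondCountableTopology Ω] [BorelSpace Ω] (P : ℕ → ProbabilityMeasure Ω)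
    (h : IsTightMeasureSet (Set.range fun n => (P n : Measure Ω))) :
    ∃ (Q : ProbabilityMeasure Ω) (φ : ℕ → ℕ), StrictMono φ ∧ Tendsto (P ∘ φ) atTop (𝓝 Q) := by
  have hcomp : IsCompact (closure (Set.range P)) :=
    isCompact_closure_of_isTightMeasureSet (h.subset (by
      rintro _ ⟨_, ⟨n, rfl⟩, rfl⟩
      exact ⟨n, rfl⟩))
  obtain ⟨Q, -, φ, hφ, hlim⟩ := hcomp.tendsto_subseq (x := P)
    fun n => subset_closure (Set.mem_range_self n)
  exact ⟨Q, φ, hφ, hlim⟩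

/-- Lower semicontinuity of the squared Wasserstein distance in its second argument, under weak
convergence with bounded second moments. -/
lemma W2sq_le_of_tendsto {x₀ : Euc d} {μ : Measure (Euc d)} [IsProbabilityMeasure μ]
    {P : ℕ → ProbabilityMeasure (Euc d)} {Q : ProbabilityMeasure (Euc d)}
    (hP : Tendsto P atTop (𝓝 Q)) {B : ℝ≥0∞} (hB : B ≠ ∞) (hμ : lmoment x₀ μ ≤ B)
    (hPB : ∀ n, lmoment x₀ (P n : Measure (Euc d)) ≤ B) {ε : ℝ} (hε : 0 ≤ ε)
    (hlt : ∀ n, W2sq μ (P n) < ε) : W2sq μ Q ≤ ε := by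
  choose π h₁ h₂ hπ using fun n => exists_coupling_of_W2sq_lt (x₀ := x₀)
    (ne_top_of_le_ne_top hB hμ) (ne_top_of_le_ne_top hB (hPB n)) (hlt n)
  obtain ⟨π', φ, hφ, hlim⟩ := exists_tendsto_subseq_of_isTightMeasureSet π (by
    refine IsTightMeasureSet.prodMk (isTightMeasureSet_of_lmoment_le (x₀ := x₀) hB ?_)
      (isTightMeasureSet_of_lmoment_le (x₀ := x₀) hB ?_)
    · rintro _ ⟨_, ⟨n, rfl⟩, rfl⟩
      simpa only [Measure.fst, h₁] using hμ
    · rintro _ ⟨_, ⟨n, rfl⟩, rfl⟩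
      simpa only [Measure.snd, h₂] using hPB n)
  have l₁ := ProbabilityMeasure.tendsto_map_of_tendsto_of_continuous _ _ hlim continuous_fst
  have l₂ := ProbabilityMeasure.tendsto_map_of_tendsto_of_continuous _ _ hlim continuous_snd
  have e₁ : π'.map continuous_fst.measurable.aemeasurable = ⟨μ, inferInstance⟩ := by
    refine tendsto_nhds_unique l₁ (tendsto_const_nhds.congr fun n => ?_)
    exact Subtype.ext (h₁ (φ n)).symm
  have e₂ : π'.map continuous_snd.measurable.aemeasurable = Q := by
    refine tendsto_nhds_unique l₂ ((hP.comp hφ.tendsto_atTop).congr fun n => ?_)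
    exact Subtype.ext (h₂ (φ n)).symm
  refine W2sq_le_of_coupling (π := (π' : Measure (Euc d × Euc d))) hε
    (congrArg ProbabilityMeasure.toMeasure e₁) (congrArg ProbabilityMeasure.toMeasure e₂) ?_
  exact lintegral_le_of_tendsto_probabilityMeasure hlim (f := fun p => ‖p.1 - p.2‖ ^ 2)
    (by fun_prop) (fun p => by positivity) tendsto_const_nhds fun n => hπ (φ n)

/-- A Wasserstein-Cauchy sequence of probability measures with convergent second-moment bounds
has a limit, whose second moment obeys the limiting bound. -/
lemma exists_tendsto_W2sq {x₀ : Euc d} (P : ℕ → ProbabilityMeasure (Euc d)) {c : ℕ → ℝ} {C : ℝ}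
    (hc : Tendsto c atTop (𝓝 C)) (hP : ∀ n, lmoment x₀ (P n : Measure (Euc d)) ≤ .ofReal (c n))
    (hcau : ∀ ε : ℝ, 0 < ε → ∃ N : ℕ, ∀ m ≥ N, ∀ n ≥ N, W2sq (P m : Measure (Euc d)) (P n) < ε) :
    ∃ Q : ProbabilityMeasure (Euc d), lmoment x₀ (Q : Measure (Euc d)) ≤ .ofReal C ∧
      Tendsto (fun n => W2sq (P n : Measure (Euc d)) Q) atTop (𝓝 0) := by
  obtain ⟨B, hB⟩ := hc.bddAbove_range
  have hPB n : lmoment x₀ (P n : Measure (Euc d)) ≤ .ofReal B :=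
    (hP n).trans (ENNReal.ofReal_le_ofReal (hB ⟨n, rfl⟩))
  obtain ⟨Q, φ, hφ, hlim⟩ := exists_tendsto_subseq_of_isTightMeasureSet P
    (isTightMeasureSet_of_lmoment_le (x₀ := x₀) ENNReal.ofReal_ne_top (by
      rintro _ ⟨n, rfl⟩
      exact hPB n))
  refine ⟨Q, ?_, ?_⟩
  · exact lintegral_le_of_tendsto_probabilityMeasure hlim (f := fun x => ‖x - x₀‖ ^ 2)
      (by fun_prop) (fun p => by positivity)
      ((ENNReal.tendsto_ofReal hc).comp hφ.tendsto_atTop) fun n => hP (φ n)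
  · rw [Metric.tendsto_atTop]
    intro ε hε
    obtain ⟨N, hN⟩ := hcau (ε / 2) (half_pos hε)
    refine ⟨N, fun n hn => ?_⟩
    have hle : W2sq (P n : Measure (Euc d)) Q ≤ ε / 2 :=
      W2sq_le_of_tendsto (x₀ := x₀) (hlim.comp (tendsto_add_atTop_nat N)) ENNReal.ofReal_ne_top
        (hPB n) (fun k => hPB _) (half_pos hε).le
        fun k => hN n hn _ ((Nat.le_add_left N k).trans (hφ.id_le _))
    rw [Real.dist_0_eq_abs, abs_of_nonneg (W2sq_nonneg _ _)]
    linarith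

lemma measurable_dil (x₀ : Euc d) (a : ℝ) : Measurable (dil x₀ a) := by
  unfold dil
  fun_prop

lemma lmoment_map_dil (x₀ : Euc d) (a : ℝ) (μ : Measure (Euc d)) :
    lmoment x₀ (μ.map (dil x₀ a)) = ENNReal.ofReal (a ^ 2) * lmoment x₀ μ := by
  unfold lmoment
  rw [lintegral_map (by fun_prop) (measurable_dil x₀ a), ← lintegral_const_mul _ (by fun_prop)]
  refine lintegral_congr fun x => ?_
  rw [← ENNReal.ofReal_mul (sq_nonneg a)]
  simp [dil, norm_smul, mul_pow]

lemma isProbabilityMeasure_nm (x₀ : Euc d) (μ : Measure (Euc d)) [IsFiniteMeasure μ] :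
    IsProbabilityMeasure (nm x₀ μ) := by
  unfold nm
  split_ifs with h
  · infer_instance
  · exact ⟨by simp [ENNReal.inv_mul_cancel h (measure_ne_top μ _)]⟩

/-- The second moment of `T_{m_μ} # μ̄` is at most `K m_μ²` for `μ ∈ M_K`. -/
lemma lmoment_map_dil_nm_le {x₀ : Euc d} {K : ℝ} {μ : Measure (Euc d)} (h : MemMK x₀ K μ) :
    lmoment x₀ ((nm x₀ μ).map (dil x₀ (mass μ))) ≤ ENNReal.ofReal (K * mass μ ^ 2) := by
  have := h.1.1
  rw [lmoment_map_dil]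
  unfold nm
  split_ifs with h₀
  · simp [lmoment]
  · have hm : 0 < mass μ := ENNReal.toReal_pos h₀ (measure_ne_top μ _)
    have hμ : μ Set.univ = ENNReal.ofReal (mass μ) :=
      (ENNReal.ofReal_toReal (measure_ne_top μ _)).symm
    have : lmoment x₀ ((μ Set.univ)⁻¹ • μ) = (μ Set.univ)⁻¹ * lmoment x₀ μ := by
      simp [lmoment, lintegral_smul_measure]
    rw [this, lmoment_eq_ofReal_sndMoment x₀ h.1, hμ, ← ENNReal.ofReal_inv_of_pos hm,
      ← ENNReal.ofReal_mul (by positivity), ← ENNReal.ofReal_mul (by positivity)]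
    refine ENNReal.ofReal_le_ofReal ?_
    calc mass μ ^ 2 * ((mass μ)⁻¹ * sndMoment x₀ μ) = mass μ * sndMoment x₀ μ := by
          field_simp
      _ ≤ mass μ * (K * mass μ) := by gcongr; exact h.2
      _ = K * mass μ ^ 2 := by ring

/-- Every probability measure with second moment at most `K m²` has the form `T_{m_ν} # ν̄` for
some `ν ∈ M_K` of mass `m`. -/
lemma exists_memMK_map_dil_nm_eq {x₀ : Euc d} {K m : ℝ} (hK : 0 ≤ K) (hm : 0 ≤ m) {Q : Measure (Euc d)}
    [IsProbabilityMeasure Q] (hQ : lmoment x₀ Q ≤ ENNReal.ofReal (K * m ^ 2)) :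
    ∃ ν : Measure (Euc d), MemMK x₀ K ν ∧ mass ν = m ∧
      (nm x₀ ν).map (dil x₀ (mass ν)) = Q := by
  rcases hm.eq_or_lt with rfl | hm
  · refine ⟨0, ⟨⟨inferInstance, by simp⟩, by simp [sndMoment, mass]⟩, by simp [mass], ?_⟩
    have h₀ : lmoment x₀ Q = 0 := by simpa using hQ
    have hae : (fun x : Euc d => x) =ᵐ[Q] fun _ => x₀ := by
      rw [lmoment, lintegral_eq_zero_iff (by fun_prop)] at h₀
      filter_upwards [h₀] with x hx
      have : ‖x - x₀‖ ^ 2 ≤ 0 := by simpa only [Pi.zero_apply, ENNReal.ofReal_eq_zero] using hx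
      have : ‖x - x₀‖ = 0 := by nlinarith [norm_nonneg (x - x₀)]
      exact sub_eq_zero.1 (norm_eq_zero.1 this)
    have hQ' : Q = Measure.dirac x₀ := by
      have : Q.map (fun x => x) = Q.map (fun _ => x₀) := Measure.map_congr hae
      rwa [Measure.map_id', Measure.map_const, measure_univ, one_smul] at this
    simp [nm, mass, hQ', Measure.map_dirac' (measurable_dil x₀ _), dil]
  · set ν : Measure (Euc d) := ENNReal.ofReal m • Q.map (dil x₀ m⁻¹) with hν
    have : IsProbabilityMeasure (Q.map (dil x₀ m⁻¹)) :=
      Measure.isProbabilityMeasure_map (measurable_dil _ _).aemeasurable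
    have huniv : ν Set.univ = ENNReal.ofReal m := by simp [hν]
    have hmass : mass ν = m := by rw [mass, huniv, ENNReal.toReal_ofReal hm.le]
    have hfin : IsFiniteMeasure ν := ⟨by simp [huniv]⟩
    have hmom : lmoment x₀ ν ≤ ENNReal.ofReal (K * m) := by
      have : lmoment x₀ ν = ENNReal.ofReal m * lmoment x₀ (Q.map (dil x₀ m⁻¹)) := by
        simp [lmoment, hν, lintegral_smul_measure]
      rw [this, lmoment_map_dil]
      grw [hQ]
      rw [← ENNReal.ofReal_mul (by positivity), ← ENNReal.ofReal_mul (by positivity)]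
      exact ENNReal.ofReal_le_ofReal (le_of_eq (by field_simp))
    have hM : MemM ν := memM_of_lmoment_ne_top (ne_top_of_le_ne_top ENNReal.ofReal_ne_top hmom)
    refine ⟨ν, ⟨hM, ?_⟩, hmass, ?_⟩
    · rw [lmoment_eq_ofReal_sndMoment x₀ hM] at hmom
      rw [hmass]
      exact (ENNReal.ofReal_le_ofReal_iff (by positivity)).1 hmom
    · have hm' : ENNReal.ofReal m ≠ 0 := by simpa using hm
      have hcomp : dil x₀ m ∘ dil x₀ m⁻¹ = id := by
        ext1 x
        simp [dil, smul_smul, hm.ne']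
      rw [nm, huniv, if_neg hm', hν, smul_smul, ENNReal.inv_mul_cancel hm' ENNReal.ofReal_ne_top,
        one_smul, hmass, Measure.map_map (measurable_dil _ _) (measurable_dil _ _), hcomp,
        Measure.map_id]

/-- `(M_K(ℝ^d), WOP)` is complete. -/
theorem WOP_complete (d : ℕ) (x₀ : Euc d) (K : ℝ) (hK : 0 < K)
    (μ : ℕ → Measure (Euc d)) (hmem : ∀ n, MemMK x₀ K (μ n))
    (hcauchy : ∀ ε : ℝ, 0 < ε → ∃ N : ℕ, ∀ m ≥ N, ∀ n ≥ N, WOP x₀ (μ m) (μ n) < ε) :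
    ∃ ν : Measure (Euc d), MemMK x₀ K ν ∧
      Filter.Tendsto (fun n => WOP x₀ (μ n) ν) Filter.atTop (nhds 0) := by
  have hfin n : IsFiniteMeasure (μ n) := (hmem n).1.1
  have hprob n : IsProbabilityMeasure ((nm x₀ (μ n)).map (dil x₀ (mass (μ n)))) :=
    have := isProbabilityMeasure_nm x₀ (μ n)
    Measure.isProbabilityMeasure_map (measurable_dil _ _).aemeasurable
  have hmass : CauchySeq fun n => mass (μ n) := by
    refine Metric.cauchySeq_iff.2 fun ε hε => ?_
    obtain ⟨N, hN⟩ := hcauchy ε hε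
    refine ⟨N, fun m hm n hn => lt_of_le_of_lt ?_ (hN m hm n hn)⟩
    rw [Real.dist_eq]
    exact Real.abs_le_sqrt (le_add_of_nonneg_right (W2sq_nonneg _ _))
  obtain ⟨m, hm⟩ := cauchySeq_tendsto_of_complete hmass
  obtain ⟨Q, hQ, hlim⟩ := exists_tendsto_W2sq (x₀ := x₀) (fun n => ⟨_, hprob n⟩)
    ((hm.pow 2).const_mul K) (fun n => lmoment_map_dil_nm_le (hmem n)) (by
      intro ε hε
      obtain ⟨N, hN⟩ := hcauchy (√ε) (Real.sqrt_pos.2 hε)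
      refine ⟨N, fun i hi j hj => ?_⟩
      have h : WOP2 x₀ (μ i) (μ j) < ε :=
        lt_of_not_ge fun h => (hN i hi j hj).not_ge (Real.sqrt_le_sqrt h)
      exact lt_of_le_of_lt (le_add_of_nonneg_left (sq_nonneg _)) h)
  obtain ⟨ν, hν, hνm, hνQ⟩ := exists_memMK_map_dil_nm_eq hK.le
    (ge_of_tendsto' hm fun n => ENNReal.toReal_nonneg) hQ
  refine ⟨ν, hν, ?_⟩
  have hsq : Tendsto (fun n => WOP2 x₀ (μ n) ν) atTop (𝓝 0) := by
    have := ((hm.sub_const m).pow 2).add hlim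
    simp only [sub_self, ne_eq, OfNat.ofNat_ne_zero, not_false_eq_true, zero_pow, add_zero] at this
    refine this.congr fun n => ?_
    rw [WOP2, hνQ, hνm]
    rfl
  simpa [WOP] using hsq.sqrt

end
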